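/- Let R > 0, let {B(x_j,R)}_{j∈ℕ} be a covering of X such that the dilated balls B(x_j,10λR) have bounded overlap (each B(x_k,10λR) meets at most C₀ = C₀(C_d) of the balls B(x_j,10λR)), and let {φ_j}_{j∈ℕ} be a partition of unity with 0 ≤ φ_j ≤ 1, each φ_j being (C/R)-Lipschitz with supp(φ_j) ⊂ B(x_j,2R), and Σ_j φ_j = 1. For u ∈ BV(X) define the discrete convolution v := Σ_{j} u_{B(x_j,5R)} φ_j. Then v ∈ N^{1,1}(X) ∩ BV(X) and ‖v‖_{BV(X)} ≤ C ‖u‖_{BV(X)}, where C depends only on C_d, C_P, λ. -/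

import Mathlib

open MeasureTheory Metric Set Filter Topology ENNReal NNReal

noncomputable section

namespace FineBV

variable {X : Type*} [MetricSpace X] [MeasurableSpace X]

/-- `g` is an upper gradient of `u` on `Ω`: for every `1`-Lipschitz
(arclength-parametrized) curve `γ : [0, ℓ] → X` with image in `Ω`,
`|u (γ ℓ) - u (γ 0)| ≤ ∫_0^ℓ g (γ t) dt`. -/
def IsUpperGradientOn (g : X → ℝ≥0∞) (u : X → ℝ) (Ω : Set X) : Prop :=
  Measurable g ∧
    ∀ (ℓ : ℝ), 0 ≤ ℓ → ∀ γ : ℝ → X, LipschitzOnWith 1 γ (Icc 0 ℓ) →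
      (∀ t ∈ Icc (0:ℝ) ℓ, γ t ∈ Ω) →
      ENNReal.ofReal |u (γ ℓ) - u (γ 0)| ≤ ∫⁻ t in Icc (0:ℝ) ℓ, g (γ t)

/-- `g` is an upper gradient of `u` on all of `X`. -/
def IsUpperGradient (g : X → ℝ≥0∞) (u : X → ℝ) : Prop :=
  IsUpperGradientOn g u univ

/-- The (extended) `L¹` norm. -/
def eL1Norm (μ : Measure X) (u : X → ℝ) : ℝ≥0∞ :=
  ∫⁻ x, ENNReal.ofReal |u x| ∂μ

/-- The (extended) Newtonian `N^{1,1}` norm. -/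
def eN11Norm (μ : Measure X) (u : X → ℝ) : ℝ≥0∞ :=
  eL1Norm μ u + ⨅ (g : X → ℝ≥0∞) (_ : IsUpperGradient g u), ∫⁻ x, g x ∂μ

/-- Membership in the Newtonian space `N^{1,1}(X)`. -/
def MemN11 (μ : Measure X) (u : X → ℝ) : Prop :=
  Measurable u ∧ eN11Norm μ u < ⊤

/-- The `1`-capacity of a set. -/
def capacity1 (μ : Measure X) (A : Set X) : ℝ≥0∞ :=
  ⨅ (u : X → ℝ) (_ : MemN11 μ u) (_ : ∀ x ∈ A, 1 ≤ u x), eN11Norm μ u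

/-- The relative (variational) `1`-capacity of `A` with respect to `Ω`. -/
def relCapacity1 (μ : Measure X) (A Ω : Set X) : ℝ≥0∞ :=
  ⨅ (u : X → ℝ) (_ : MemN11 μ u) (g : X → ℝ≥0∞) (_ : IsUpperGradient g u)
    (_ : ∀ x ∈ A, 1 ≤ u x) (_ : ∀ x, x ∉ Ω → u x = 0),
    ∫⁻ x in Ω, g x ∂μ

/-- `A` is `1`-thin at `x`. -/
def OneThinAt (μ : Measure X) (A : Set X) (x : X) : Prop :=
  Tendsto (fun r : ℝ =>
      ENNReal.ofReal r * relCapacity1 μ (A ∩ ball x r) (ball x (2 * r)) / μ (ball x r))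
    (𝓝[>] 0) (𝓝 0)

/-- `U` is `1`-finely open. -/
def OneFinelyOpen (μ : Measure X) (U : Set X) : Prop :=
  ∀ x ∈ U, OneThinAt μ Uᶜ x

/-- `F` is `1`-finely closed. -/
def OneFinelyClosed (μ : Measure X) (F : Set X) : Prop :=
  OneFinelyOpen μ Fᶜ

/-- The `1`-fine closure: the smallest `1`-finely closed set containing `G`. -/
def oneFineClosure (μ : Measure X) (G : Set X) : Set X :=
  ⋂₀ {F : Set X | G ⊆ F ∧ OneFinelyClosed μ F}

/-- `μ` is doubling with constant `Cd`: balls have positive finite measure and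
`μ(B(x,2r)) ≤ Cd · μ(B(x,r))`. -/
def DoublingWith (μ : Measure X) (Cd : ℝ≥0) : Prop :=
  ∀ (x : X) (r : ℝ), 0 < r →
    0 < μ (ball x r) ∧ μ (ball x (2 * r)) ≤ (Cd : ℝ≥0∞) * μ (ball x r) ∧ μ (ball x r) < ⊤

/-- `u` is Lipschitz on compact subsets of `Ω` (locally Lipschitz in `Ω`). -/
def LocLipschitzOn (u : X → ℝ) (Ω : Set X) : Prop :=
  ∀ K : Set X, K ⊆ Ω → IsCompact K → ∃ L : ℝ≥0, LipschitzOnWith L u K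

/-- The total variation `‖Du‖(Ω)`. -/
def totalVariation (μ : Measure X) (u : X → ℝ) (Ω : Set X) : ℝ≥0∞ :=
  ⨅ (v : ℕ → X → ℝ) (g : ℕ → X → ℝ≥0∞)
    (_ : ∀ i, LocLipschitzOn (v i) Ω)
    (_ : ∀ i, IsUpperGradientOn (g i) (v i) Ω)
    (_ : ∀ K : Set X, K ⊆ Ω → IsCompact K →
        Tendsto (fun i => ∫⁻ x in K, ENNReal.ofReal |v i x - u x| ∂μ) atTop (𝓝 0)),
    Filter.atTop.liminf fun i => ∫⁻ x in Ω, g i x ∂μ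

/-- The perimeter `P(E,Ω) = ‖Dχ_E‖(Ω)`. -/
def perimeter (μ : Measure X) (E Ω : Set X) : ℝ≥0∞ :=
  totalVariation μ (Set.indicator E fun _ => (1 : ℝ)) Ω

/-- `u ∈ BV(X)`. -/
def MemBV (μ : Measure X) (u : X → ℝ) : Prop :=
  Integrable u μ ∧ totalVariation μ u univ < ⊤

/-- The (extended) `BV` norm. -/
def eBVNorm (μ : Measure X) (u : X → ℝ) : ℝ≥0∞ :=
  eL1Norm μ u + totalVariation μ u univ

/-- The `(1,1)`-Poincaré inequality with constants `CP`, `lam`. -/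
def PoincareIneq (μ : Measure X) (CP lam : ℝ) : Prop :=
  ∀ (x : X) (r : ℝ), 0 < r → ∀ (u : X → ℝ) (g : X → ℝ≥0∞),
    LocallyIntegrable u μ → IsUpperGradient g u →
    (∫⁻ y in ball x r, ENNReal.ofReal |u y - ⨍ z in ball x r, u z ∂μ| ∂μ) / μ (ball x r)
      ≤ ENNReal.ofReal (CP * r) * ((∫⁻ y in ball x (lam * r), g y ∂μ) / μ (ball x (lam * r)))

/-- The restricted spherical Hausdorff content of codimension 1, at scale `R`. -/
def codimHContent (μ : Measure X) (R : ℝ) (A : Set X) : ℝ≥0∞ :=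
  ⨅ (c : ℕ → X) (r : ℕ → ℝ) (_ : ∀ i, 0 < r i ∧ r i ≤ R)
    (_ : A ⊆ ⋃ i, ball (c i) (r i)),
    ∑' i, μ (ball (c i) (r i)) / ENNReal.ofReal (r i)

/-- The codimension 1 Hausdorff measure `H(A) = lim_{R→0⁺} H_R(A)`. -/
def codimH (μ : Measure X) (A : Set X) : ℝ≥0∞ :=
  ⨆ (R : ℝ) (_ : 0 < R), codimHContent μ R A

/-- The measure-theoretic interior `I_E`. -/
def measInterior (μ : Measure X) (E : Set X) : Set X :=
  {x | Tendsto (fun r : ℝ => μ (ball x r \ E) / μ (ball x r)) (𝓝[>] 0) (𝓝 0)}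

/-- The measure-theoretic boundary `∂*E`. -/
def measBoundary (μ : Measure X) (E : Set X) : Set X :=
  {x | 0 < limsup (fun r : ℝ => μ (ball x r ∩ E) / μ (ball x r)) (𝓝[>] 0) ∧
       0 < limsup (fun r : ℝ => μ (ball x r \ E) / μ (ball x r)) (𝓝[>] 0)}

/-- The lower approximate limit `u^∧`. -/
def lowerApprox (μ : Measure X) (u : X → ℝ) (x : X) : EReal :=
  sSup {t : EReal |
    Tendsto (fun r : ℝ => μ (ball x r ∩ {y | (u y : EReal) < t}) / μ (ball x r))
      (𝓝[>] 0) (𝓝 0)}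

/-- The upper approximate limit `u^∨`. -/
def upperApprox (μ : Measure X) (u : X → ℝ) (x : X) : EReal :=
  sInf {t : EReal |
    Tendsto (fun r : ℝ => μ (ball x r ∩ {y | t < (u y : EReal)}) / μ (ball x r))
      (𝓝[>] 0) (𝓝 0)}

/-- The next jump value after the value `p` at `x`. -/
def jumpNext (μ : Measure X) (u : X → ℝ) (p : EReal) (x : X) : EReal :=
  sSup {t : EReal | ∀ δ : ℝ, 0 < δ →
    Tendsto (fun r : ℝ =>
        μ (ball x r ∩ {y | p + (δ : EReal) < (u y : EReal) ∧ (u y : EReal) < t}) /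
          μ (ball x r))
      (𝓝[>] 0) (𝓝 0)}

/-- Auxiliary jump values: `jumpAux μ u (l-1)` is the `l`-th jump value for `l < n`. -/
def jumpAux (μ : Measure X) (u : X → ℝ) : ℕ → X → EReal
  | 0 => lowerApprox μ u
  | (l + 1) => fun x =>
      if jumpAux μ u l x < upperApprox μ u x then jumpNext μ u (jumpAux μ u l x) x
      else upperApprox μ u x

/-- The jump values `u^l`, `l = 1, …, n`, with `u^1 = u^∧` and `u^n = u^∨`. -/
def jumpVal (μ : Measure X) (u : X → ℝ) (n l : ℕ) : X → EReal :=
  if l = n then upperApprox μ u else jumpAux μ u (l - 1)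

/-- The extended absolute difference `|a - b|` of two extended reals, with the
convention that it is `∞` whenever exactly one of them is infinite or they are
distinct infinities, and `0` when `a = b`. -/
def eAbsDiff (a b : EReal) : ℝ≥0∞ :=
  if a = b then 0
  else if a = ⊤ ∨ a = ⊥ ∨ b = ⊤ ∨ b = ⊥ then ⊤
  else ENNReal.ofReal |a.toReal - b.toReal|

/-- `γ` satisfies the density-bound property: for every set of finite perimeter `E`,
`H`-a.e. point of `∂*E` has lower density `≥ γ` and upper density `≤ 1 - γ`. -/
def GammaDensityProperty (μ : Measure X) (γ : ℝ) : Prop :=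
  ∀ E : Set X, MeasurableSet E → perimeter μ E univ < ⊤ →
    codimH μ {x ∈ measBoundary μ E |
      ¬ (ENNReal.ofReal γ ≤
            Filter.liminf (fun r : ℝ => μ (ball x r ∩ E) / μ (ball x r)) (𝓝[>] 0) ∧
          Filter.limsup (fun r : ℝ => μ (ball x r ∩ E) / μ (ball x r)) (𝓝[>] 0) ≤
            ENNReal.ofReal (1 - γ))} = 0

/-- `v` is a discrete convolution of `u` at scale `R` (with dilation parameter `lam`). -/
def IsDiscreteConvolution (μ : Measure X) (lam R : ℝ) (u v : X → ℝ) : Prop :=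
  ∃ (c : ℕ → X) (φ : ℕ → X → ℝ),
    (∀ z : X, ∃ j, z ∈ ball (c j) R) ∧
    (∃ C₀ : ℕ, ∀ k : ℕ,
      {j : ℕ | (ball (c j) (10 * lam * R) ∩ ball (c k) (10 * lam * R)).Nonempty}.Finite ∧
      {j : ℕ | (ball (c j) (10 * lam * R) ∩ ball (c k) (10 * lam * R)).Nonempty}.ncard ≤ C₀) ∧
    (∀ j z, 0 ≤ φ j z ∧ φ j z ≤ 1) ∧
    (∃ L : ℝ≥0, ∀ j, LipschitzWith (L * (Real.toNNReal R)⁻¹) (φ j)) ∧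
    (∀ j, tsupport (φ j) ⊆ ball (c j) (2 * R)) ∧
    (∀ z : X, HasSum (fun j => φ j z) 1) ∧
    (∀ z : X, v z = ∑' j, (⨍ y in ball (c j) (5 * R), u y ∂μ) * φ j z)


set_option linter.unusedSectionVars false

lemma DoublingWith.measure_ball_two_pow_le {μ : Measure X} {Cd : ℝ≥0} (hμ : DoublingWith μ Cd)
    (x : X) {r : ℝ} (hr : 0 < r) (n : ℕ) :
    μ (ball x (2 ^ n * r)) ≤ (Cd : ℝ≥0∞) ^ n * μ (ball x r) := by
  induction n with
  | zero => simp
  | succ n ih =>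
    calc μ (ball x (2 ^ (n + 1) * r)) = μ (ball x (2 * (2 ^ n * r))) := by congr 2; ring
      _ ≤ Cd * μ (ball x (2 ^ n * r)) := (hμ x _ (by positivity)).2.1
      _ ≤ Cd * ((Cd : ℝ≥0∞) ^ n * μ (ball x r)) := by gcongr
      _ = _ := by ring

lemma DoublingWith.totallyBounded_ball [BorelSpace X] {μ : Measure X} {Cd : ℝ≥0}
    (hμ : DoublingWith μ Cd) (x : X) {r : ℝ} (hr : 0 < r) : TotallyBounded (ball x r) := by
  rw [Metric.totallyBounded_iff]
  intro ε hε
  by_contra! h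
  obtain ⟨s, hs, hsep⟩ : ∃ s : ℕ → X, (∀ n, s n ∈ ball x r) ∧
      ∀ n m, m < n → s n ∉ ball (s m) ε := by
    simp only [not_subset, mem_iUnion₂, not_exists, exists_prop] at h
    simpa only [forall_and, forall_mem_image, not_and] using! seq_of_forall_finite_exists h
  have hdist : ∀ m n, m ≠ n → ε ≤ dist (s m) (s n) := by
    intro m n hmn
    rcases lt_or_gt_of_ne hmn with h | h
    · have := hsep n m h
      rw [mem_ball, not_lt, dist_comm] at this
      exact this
    · have := hsep m n h
      rwa [mem_ball, not_lt] at this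
  have hdisj : Pairwise (Function.onFun Disjoint fun n => ball (s n) (ε / 2)) := by
    intro m n hmn
    exact ball_disjoint_ball (by linarith [hdist m n hmn])
  obtain ⟨N, hN⟩ : ∃ N : ℕ, (2 * r + ε) / (ε / 2) < 2 ^ N := pow_unbounded_of_one_lt _ (by norm_num)
  have hN' : 2 * r + ε ≤ 2 ^ N * (ε / 2) := ((div_lt_iff₀ (by positivity)).1 hN).le
  set V := μ (ball x (r + ε)) with hV
  have hVpos : V ≠ 0 := (hμ x (r + ε) (by positivity)).1.ne'
  have hVfin : V ≠ ⊤ := (hμ x (r + ε) (by positivity)).2.2.ne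
  have hlow : ∀ n, V / (Cd : ℝ≥0∞) ^ N ≤ μ (ball (s n) (ε / 2)) := by
    intro n
    refine ENNReal.div_le_of_le_mul' ?_
    refine le_trans (measure_mono (ball_subset_ball' ?_))
      (hμ.measure_ball_two_pow_le (s n) (half_pos hε) N)
    have := mem_ball.1 (hs n)
    rw [dist_comm] at this
    linarith
  have hsum : ∑' n, μ (ball (s n) (ε / 2)) ≤ V := by
    refine (tsum_meas_le_meas_iUnion_of_disjoint μ (fun _ => measurableSet_ball) hdisj).trans
      (measure_mono (iUnion_subset fun n => ball_subset_ball' ?_))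
    have := mem_ball.1 (hs n)
    linarith
  have htop : ∑' _ : ℕ, V / (Cd : ℝ≥0∞) ^ N = ⊤ := by
    refine ENNReal.tsum_const_eq_top_of_ne_zero ?_
    exact (ENNReal.div_pos hVpos (by finiteness)).ne'
  exact hVfin (top_le_iff.1 (htop ▸ (ENNReal.tsum_le_tsum hlow).trans hsum))

lemma DoublingWith.properSpace [CompleteSpace X] [BorelSpace X] {μ : Measure X} {Cd : ℝ≥0}
    (hμ : DoublingWith μ Cd) : ProperSpace X := by
  refine ⟨fun x r => ?_⟩
  refine TotallyBounded.isCompact_of_isClosed ?_ isClosed_closedBall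
  exact (hμ.totallyBounded_ball x (r := |r| + 1) (by positivity)).subset
    (closedBall_subset_ball (by linarith [le_abs_self r]))

lemma DoublingWith.isLocallyFiniteMeasure {μ : Measure X} {Cd : ℝ≥0}
    (hμ : DoublingWith μ Cd) : IsLocallyFiniteMeasure μ :=
  ⟨fun x => ⟨ball x 1, ball_mem_nhds x one_pos, (hμ x 1 one_pos).2.2⟩⟩

lemma LocLipschitzOn.continuous [ProperSpace X] {u : X → ℝ} (hu : LocLipschitzOn u univ) :
    Continuous u := by
  rw [continuous_iff_continuousAt]
  intro x
  obtain ⟨K, hK⟩ := hu (closedBall x 1) (subset_univ _) (isCompact_closedBall x 1)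
  exact hK.continuousOn.continuousAt (closedBall_mem_nhds x one_pos)

/-- The integral over `s` of the deviation of `u` from its mean value over `s`. -/
def meanDeviation (μ : Measure X) (u : X → ℝ) (s : Set X) : ℝ≥0∞ :=
  ∫⁻ y in s, ENNReal.ofReal |u y - ⨍ z in s, u z ∂μ| ∂μ

lemma ofReal_abs_setAverage_sub_le {μ : Measure X} {u : X → ℝ} {s : Set X}
    (hs0 : μ s ≠ 0) (hs : μ s ≠ ⊤) (hu : IntegrableOn u s μ) (a : ℝ) :
    ENNReal.ofReal |(⨍ y in s, u y ∂μ) - a| ≤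
      (∫⁻ y in s, ENNReal.ofReal |u y - a| ∂μ) / μ s := by
  have hconst : IntegrableOn (fun _ : X => a) s μ := integrableOn_const hs
  have hpos : 0 < μ.real s := ENNReal.toReal_pos hs0 hs
  have h1 : (⨍ y in s, u y ∂μ) - a = (μ.real s)⁻¹ * ∫ y in s, (u y - a) ∂μ := by
    rw [setAverage_eq, integral_sub hu hconst, setIntegral_const, smul_eq_mul, smul_eq_mul]
    field_simp
  have h2 : ENNReal.ofReal |∫ y in s, (u y - a) ∂μ| ≤ ∫⁻ y in s, ENNReal.ofReal |u y - a| ∂μ := by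
    have := enorm_integral_le_lintegral_enorm (μ := μ.restrict s) (fun y => u y - a)
    simpa only [Real.enorm_eq_ofReal_abs] using this
  rw [h1, abs_mul, ENNReal.ofReal_mul (abs_nonneg _), abs_of_pos (inv_pos.2 hpos),
    ENNReal.ofReal_inv_of_pos hpos, Measure.real, ENNReal.ofReal_toReal hs, mul_comm,
    ENNReal.div_eq_inv_mul, mul_comm]
  gcongr

lemma meanDeviation_le_add {μ : Measure X} {u v : X → ℝ} {s : Set X}
    (hs0 : μ s ≠ 0) (hs : μ s ≠ ⊤) (hu : IntegrableOn u s μ) (hv : IntegrableOn v s μ) :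
    meanDeviation μ u s ≤
      meanDeviation μ v s + 2 * ∫⁻ y in s, ENNReal.ofReal |v y - u y| ∂μ := by
  set a := ⨍ z in s, u z ∂μ with ha
  set b := ⨍ z in s, v z ∂μ with hb
  set E := ∫⁻ y in s, ENNReal.ofReal |v y - u y| ∂μ with hE
  have hab : ENNReal.ofReal |b - a| * μ s ≤ E := by
    have h1 : b - a = (⨍ y in s, (v y - u y) ∂μ) - 0 := by
      rw [ha, hb, setAverage_eq, setAverage_eq, setAverage_eq, integral_sub hv hu]
      simp only [smul_eq_mul]; ring
    have h2 := ofReal_abs_setAverage_sub_le hs0 hs (hv.sub hu) 0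
    simp only [Pi.sub_apply, sub_zero] at h2
    rw [h1, sub_zero]
    exact (ENNReal.le_div_iff_mul_le (Or.inl hs0) (Or.inl hs)).1 h2
  have hvb : AEMeasurable (fun y => ENNReal.ofReal |v y - b|) (μ.restrict s) :=
    (hv.aemeasurable.sub_const b).abs.ennreal_ofReal
  have hvu : AEMeasurable (fun y => ENNReal.ofReal |v y - u y|) (μ.restrict s) :=
    (hv.aemeasurable.sub hu.aemeasurable).abs.ennreal_ofReal
  calc meanDeviation μ u s
      ≤ ∫⁻ y in s, (ENNReal.ofReal |v y - b| + ENNReal.ofReal |v y - u y|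
          + ENNReal.ofReal |b - a|) ∂μ := by
        refine lintegral_mono fun y => ?_
        rw [← ENNReal.ofReal_add (abs_nonneg _) (abs_nonneg _),
          ← ENNReal.ofReal_add (by positivity) (abs_nonneg _)]
        refine ENNReal.ofReal_le_ofReal ?_
        have e : u y - a = (v y - b) - (v y - u y) + (b - a) := by ring
        rw [e]
        exact (abs_add_le _ _).trans (by gcongr; exact abs_sub _ _)
    _ = meanDeviation μ v s + E + ENNReal.ofReal |b - a| * μ s := by
        rw [lintegral_add_right _ measurable_const, lintegral_add_left' hvb, setLIntegral_const]
        rfl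
    _ ≤ meanDeviation μ v s + E + E := by gcongr
    _ = _ := by rw [two_mul, add_assoc]

lemma PoincareIneq.meanDeviation_ball_le {μ : Measure X} {Cd : ℝ≥0} {CP lam : ℝ}
    (hμ : DoublingWith μ Cd) (hP : PoincareIneq μ CP lam) (hlam : 1 ≤ lam) {x : X} {r : ℝ}
    (hr : 0 < r) {u : X → ℝ} {g : X → ℝ≥0∞} (hu : LocallyIntegrable u μ)
    (hg : IsUpperGradient g u) :
    meanDeviation μ u (ball x r) ≤ ENNReal.ofReal (CP * r) * ∫⁻ y in ball x (lam * r), g y ∂μ := by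
  have hr' : r ≤ lam * r := le_mul_of_one_le_left hr.le hlam
  obtain ⟨h0, -, ht⟩ := hμ x r hr
  obtain ⟨h0', -, ht'⟩ := hμ x (lam * r) (hr.trans_le hr')
  have hle := (ENNReal.div_le_iff h0.ne' ht.ne).1 (hP x r hr u g hu hg)
  refine hle.trans ?_
  rw [mul_assoc]
  gcongr
  calc _ ≤ (∫⁻ y in ball x (lam * r), g y ∂μ) / μ (ball x (lam * r)) * μ (ball x (lam * r)) := by
        gcongr
    _ = _ := ENNReal.div_mul_cancel h0'.ne' ht'.ne

/-- The Poincaré inequality along a sequence approximating `u` in `L¹`. -/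
lemma PoincareIneq.meanDeviation_ball_le_liminf [ProperSpace X] [BorelSpace X] {μ : Measure X}
    {Cd : ℝ≥0} {CP lam : ℝ} (hμ : DoublingWith μ Cd) (hP : PoincareIneq μ CP lam) (hlam : 1 ≤ lam)
    (x : X) {r : ℝ} (hr : 0 < r) {u : X → ℝ} (hu : Integrable u μ) {v : ℕ → X → ℝ}
    {g : ℕ → X → ℝ≥0∞} (hv : ∀ i, LocLipschitzOn (v i) univ)
    (hg : ∀ i, IsUpperGradient (g i) (v i))
    (hlim : ∀ K : Set X, IsCompact K →
      Tendsto (fun i => ∫⁻ x in K, ENNReal.ofReal |v i x - u x| ∂μ) atTop (𝓝 0)) :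
    meanDeviation μ u (ball x r) ≤
      liminf (fun i => ENNReal.ofReal (CP * r) * ∫⁻ y in ball x (lam * r), g i y ∂μ) atTop := by
  have := hμ.isLocallyFiniteMeasure
  have hloc : ∀ i, LocallyIntegrable (v i) μ := fun i => (hv i).continuous.locallyIntegrable
  obtain ⟨h0, -, ht⟩ := hμ x r hr
  have hzero : Tendsto (fun i => 2 * ∫⁻ y in ball x r, ENNReal.ofReal |v i y - u y| ∂μ)
      atTop (𝓝 0) := by
    have h1 := hlim (closedBall x r) (isCompact_closedBall x r)
    have h2 : Tendsto (fun i => ∫⁻ y in ball x r, ENNReal.ofReal |v i y - u y| ∂μ)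
        atTop (𝓝 0) :=
      tendsto_of_tendsto_of_tendsto_of_le_of_le tendsto_const_nhds h1 (fun _ => zero_le)
        fun i => lintegral_mono_set ball_subset_closedBall
    simpa using ENNReal.Tendsto.const_mul h2 (Or.inr ENNReal.ofNat_ne_top)
  have key : ∀ i, meanDeviation μ u (ball x r) ≤
      ((fun i => ENNReal.ofReal (CP * r) * ∫⁻ y in ball x (lam * r), g i y ∂μ) +
        fun i => 2 * ∫⁻ y in ball x r, ENNReal.ofReal |v i y - u y| ∂μ) i := by
    intro i
    refine (meanDeviation_le_add h0.ne' ht.ne hu.integrableOn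
      (((hloc i).integrableOn_isCompact (isCompact_closedBall x r)).mono_set
        ball_subset_closedBall)).trans ?_
    exact add_le_add_left (hP.meanDeviation_ball_le hμ hlam hr (hloc i) (hg i)) _
  rw [← ENNReal.liminf_add_of_right_tendsto_zero hzero]
  exact le_liminf_of_le (by isBoundedDefault) (Eventually.of_forall key)

lemma tsum_setLIntegral_le_of_overlap {μ : Measure X} {s t : ℕ → Set X} {C₀ : ℕ}
    (hs : ∀ k, {j | (s j ∩ s k).Nonempty}.Finite ∧ {j | (s j ∩ s k).Nonempty}.ncard ≤ C₀)
    (hts : ∀ k, t k ⊆ s k) (ht : ∀ k, MeasurableSet (t k)) {f : X → ℝ≥0∞}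
    (hf : AEMeasurable f μ) :
    ∑' k, ∫⁻ x in t k, f x ∂μ ≤ C₀ * ∫⁻ x, f x ∂μ := by
  simp_rw [← lintegral_indicator (ht _)]
  rw [← lintegral_tsum fun k => hf.indicator (ht k), ← lintegral_const_mul' _ _ (by simp)]
  refine lintegral_mono fun x => ?_
  by_cases hx : ∃ k, x ∈ t k
  · obtain ⟨k, hk⟩ := hx
    obtain ⟨hfin, hcard⟩ := hs k
    rw [tsum_eq_sum (s := hfin.toFinset)]
    · calc ∑ j ∈ hfin.toFinset, (t j).indicator f x ≤ ∑ _j ∈ hfin.toFinset, f x :=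
            Finset.sum_le_sum fun j _ => indicator_le_self _ _ _
        _ = hfin.toFinset.card * f x := by rw [Finset.sum_const, nsmul_eq_mul]
        _ ≤ C₀ * f x := by
            rw [ncard_eq_toFinset_card _ hfin] at hcard
            gcongr
    · intro j hj
      refine indicator_of_notMem (fun hxj => hj ?_) f
      exact hfin.mem_toFinset.2 ⟨x, hts j hxj, hts k hk⟩
  · push Not at hx
    simp [indicator_of_notMem (hx _)]

lemma isUpperGradient_of_lipschitzOnWith [OpensMeasurableSpace X] {ι : Type*} [Countable ι]
    {B : ι → Set X} (hB : ∀ i, IsOpen (B i)) (hcov : ∀ x, ∃ i, x ∈ B i) {G : ι → ℝ≥0} {v : X → ℝ}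
    (hv : ∀ i, LipschitzOnWith (G i) v (B i)) :
    IsUpperGradient (fun x => ∑' i, (B i).indicator (fun _ => (G i : ℝ≥0∞)) x) v := by
  refine ⟨Measurable.tsum fun i => measurable_const.indicator (hB i).measurableSet, ?_⟩
  intro ℓ hℓ γ hγ _
  set f : ℝ → ℝ≥0∞ := fun t => ∑' i, (B i).indicator (fun _ => (G i : ℝ≥0∞)) (γ t) with hf
  have hcont : Continuous fun t : Icc (0 : ℝ) ℓ => γ t :=
    continuousOn_iff_continuous_domRestrict.1 hγ.continuousOn
  obtain ⟨t, ht0, hmono, ⟨m, hm⟩, hsub⟩ := exists_monotone_Icc_subset_open_cover_Icc hℓ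
    (c := fun i => {τ : Icc (0 : ℝ) ℓ | γ τ ∈ B i}) (fun i => (hB i).preimage hcont)
    (fun τ _ => mem_iUnion.2 (hcov (γ τ)))
  have step : ∀ n, ENNReal.ofReal |v (γ (t (n + 1))) - v (γ (t n))| ≤
      ∫⁻ τ in Ioc (t n : ℝ) (t (n + 1)), f τ := by
    intro n
    have hle : (t n : ℝ) ≤ t (n + 1) := hmono n.le_succ
    obtain ⟨i, hi⟩ := hsub n
    have hmem : ∀ τ ∈ Icc (t n : ℝ) (t (n + 1)), γ τ ∈ B i := fun τ hτ =>
      hi (a := ⟨τ, (t n).2.1.trans hτ.1, hτ.2.trans (t (n + 1)).2.2⟩) ⟨hτ.1, hτ.2⟩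
    have h1 : |v (γ (t (n + 1))) - v (γ (t n))| ≤ G i * (t (n + 1) - t n) := by
      rw [← Real.dist_eq]
      refine ((hv i).dist_le_mul _ (hmem _ ⟨hle, le_rfl⟩) _ (hmem _ ⟨le_rfl, hle⟩)).trans ?_
      have := hγ.dist_le_mul _ (t (n + 1)).2 _ (t n).2
      rw [NNReal.coe_one, one_mul, Real.dist_eq, abs_of_nonneg (sub_nonneg.2 hle)] at this
      gcongr
    calc ENNReal.ofReal |v (γ (t (n + 1))) - v (γ (t n))|
        ≤ ENNReal.ofReal (G i * (t (n + 1) - t n)) := ENNReal.ofReal_le_ofReal h1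
      _ = ∫⁻ _ in Ioc (t n : ℝ) (t (n + 1)), (G i : ℝ≥0∞) := by
          rw [setLIntegral_const, Real.volume_Ioc, ENNReal.ofReal_mul (NNReal.coe_nonneg _),
            ENNReal.ofReal_coe_nnreal]
      _ ≤ ∫⁻ τ in Ioc (t n : ℝ) (t (n + 1)), f τ := by
          refine setLIntegral_mono' measurableSet_Ioc fun τ hτ => ?_
          refine le_trans ?_ (ENNReal.le_tsum i)
          rw [indicator_of_mem (hmem τ (Ioc_subset_Icc_self hτ))]
  have main : ∀ n, ENNReal.ofReal |v (γ (t n)) - v (γ 0)| ≤ ∫⁻ τ in Ioc 0 (t n : ℝ), f τ := by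
    intro n
    induction n with
    | zero => simp [ht0]
    | succ n ih =>
      have hle : (t n : ℝ) ≤ t (n + 1) := hmono n.le_succ
      rw [← Ioc_union_Ioc_eq_Ioc (t n).2.1 hle,
        lintegral_union measurableSet_Ioc (Ioc_disjoint_Ioc_of_le le_rfl)]
      refine le_trans ?_ (add_le_add ih (step n))
      rw [← ENNReal.ofReal_add (abs_nonneg _) (abs_nonneg _)]
      refine ENNReal.ofReal_le_ofReal ?_
      rw [add_comm |v (γ (t n)) - v (γ 0)|]
      exact abs_sub_le _ _ _
  have := main m
  rw [hm m le_rfl] at this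
  exact this.trans (lintegral_mono_set Ioc_subset_Icc_self)

lemma lipschitzOnWith_tsum_mul {B : Set X} {N : Finset ℕ} {n : ℕ} (hN : N.card ≤ n) {A Λ : ℝ≥0}
    {a : ℕ → ℝ} {b : ℝ} {φ : ℕ → X → ℝ} (hφB : ∀ j ∉ N, ∀ z ∈ B, φ j z = 0)
    (hφ : ∀ j, LipschitzWith Λ (φ j)) (hsum : ∀ z, HasSum (fun j => φ j z) 1)
    (ha : ∀ j ∈ N, |a j - b| ≤ A) :
    LipschitzOnWith (n * A * Λ) (fun z => ∑' j, a j * φ j z) B := by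
  have key : ∀ z ∈ B, ∑' j, a j * φ j z = b + ∑ j ∈ N, (a j - b) * φ j z := by
    intro z hz
    have h1 : ∑ j ∈ N, φ j z = 1 :=
      (hasSum_sum_of_ne_finset_zero fun j hj => hφB j hj z hz).unique (hsum z)
    rw [tsum_eq_sum (s := N) fun j hj => by rw [hφB j hj z hz, mul_zero]]
    simp_rw [sub_mul]
    rw [Finset.sum_sub_distrib, ← Finset.mul_sum, h1]
    ring
  refine LipschitzOnWith.of_dist_le_mul fun z hz w hw => ?_
  simp only [key z hz, key w hw, Real.dist_eq]
  rw [add_sub_add_left_eq_sub, ← Finset.sum_sub_distrib]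
  calc |∑ j ∈ N, ((a j - b) * φ j z - (a j - b) * φ j w)|
      ≤ ∑ j ∈ N, |(a j - b) * φ j z - (a j - b) * φ j w| := Finset.abs_sum_le_sum_abs _ _
    _ ≤ ∑ _j ∈ N, (A * (Λ * dist z w) : ℝ) := by
        refine Finset.sum_le_sum fun j hj => ?_
        rw [← mul_sub, abs_mul]
        have := (hφ j).dist_le_mul z w
        rw [Real.dist_eq] at this
        gcongr
        exact ha j hj
    _ = N.card * (A * (Λ * dist z w)) := by rw [Finset.sum_const, nsmul_eq_mul]
    _ ≤ n * (A * (Λ * dist z w)) := by gcongr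
    _ = _ := by push_cast; ring

lemma DoublingWith.ofReal_abs_setAverage_sub_setAverage_le [OpensMeasurableSpace X]
    {μ : Measure X} {Cd : ℝ≥0} (hμ : DoublingWith μ Cd) {u : X → ℝ} (hu : Integrable u μ) {x y : X}
    {R : ℝ} (hR : 0 < R) (hxy : dist x y ≤ 3 * R) :
    ENNReal.ofReal |(⨍ z in ball x (5 * R), u z ∂μ) - ⨍ z in ball y (8 * R), u z ∂μ| ≤
      Cd ^ 2 * meanDeviation μ u (ball y (8 * R)) / μ (ball y (8 * R)) := by
  obtain ⟨h5, -, h5t⟩ := hμ x (5 * R) (by positivity)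
  obtain ⟨h8, -, h8t⟩ := hμ y (8 * R) (by positivity)
  refine (ofReal_abs_setAverage_sub_le h5.ne' h5t.ne hu.integrableOn _).trans ?_
  have hsub : ball x (5 * R) ⊆ ball y (8 * R) := ball_subset_ball' (by linarith)
  have hle : μ (ball y (8 * R)) ≤ Cd ^ 2 * μ (ball x (5 * R)) :=
    (measure_mono (ball_subset_ball' (by rw [dist_comm] at hxy; linarith))).trans
      (hμ.measure_ball_two_pow_le x (by positivity) 2)
  rw [ENNReal.div_le_iff h5.ne' h5t.ne]
  calc ∫⁻ z in ball x (5 * R), ENNReal.ofReal |u z - ⨍ z in ball y (8 * R), u z ∂μ| ∂μ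
      ≤ meanDeviation μ u (ball y (8 * R)) := lintegral_mono_set hsub
    _ = meanDeviation μ u (ball y (8 * R)) / μ (ball y (8 * R)) * μ (ball y (8 * R)) :=
        (ENNReal.div_mul_cancel h8.ne' h8t.ne).symm
    _ ≤ meanDeviation μ u (ball y (8 * R)) / μ (ball y (8 * R)) *
          (Cd ^ 2 * μ (ball x (5 * R))) := by gcongr
    _ = _ := by rw [mul_div_assoc]; ring

lemma PoincareIneq.tsum_meanDeviation_le [ProperSpace X] [BorelSpace X] {μ : Measure X}
    {Cd : ℝ≥0} {CP lam : ℝ} (hμ : DoublingWith μ Cd) (hP : PoincareIneq μ CP lam) (hCP : 0 < CP)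
    (hlam : 1 ≤ lam) {r : ℝ} (hr : 0 < r) {c : ℕ → X} {s : ℕ → Set X} {C₀ : ℕ}
    (hs : ∀ k, {j | (s j ∩ s k).Nonempty}.Finite ∧ {j | (s j ∩ s k).Nonempty}.ncard ≤ C₀)
    (hC₀ : C₀ ≠ 0) (hcs : ∀ k, ball (c k) (lam * r) ⊆ s k) {u : X → ℝ} (hu : Integrable u μ) :
    ∑' k, meanDeviation μ u (ball (c k) r) ≤
      ENNReal.ofReal (CP * r) * C₀ * totalVariation μ u univ := by
  have hb0 : ENNReal.ofReal (CP * r) ≠ 0 := (ENNReal.ofReal_pos.2 (by positivity)).ne'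
  have hK0 : ENNReal.ofReal (CP * r) * C₀ ≠ 0 := mul_ne_zero hb0 (by simpa using hC₀)
  have hKt : ENNReal.ofReal (CP * r) * C₀ ≠ ⊤ := by finiteness
  rw [← ENNReal.div_le_iff' hK0 hKt]
  refine le_iInf fun v => le_iInf fun g => le_iInf fun hv => le_iInf fun hg => le_iInf fun hlim => ?_
  rw [ENNReal.div_le_iff' hK0 hKt]
  simp only [Measure.restrict_univ]
  calc ∑' k, meanDeviation μ u (ball (c k) r)
      ≤ ∑' k, liminf (fun i => ENNReal.ofReal (CP * r) *
          ∫⁻ y in ball (c k) (lam * r), g i y ∂μ) atTop :=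
        ENNReal.tsum_le_tsum fun k => hP.meanDeviation_ball_le_liminf hμ hlam (c k) hr hu hv hg
          fun K hK => hlim K (subset_univ K) hK
    _ ≤ liminf (fun i => ∑' k, ENNReal.ofReal (CP * r) *
          ∫⁻ y in ball (c k) (lam * r), g i y ∂μ) atTop := by
        simp_rw [← lintegral_count]
        exact lintegral_liminf_le fun i => measurable_from_top
    _ ≤ liminf (fun i => ENNReal.ofReal (CP * r) * C₀ * ∫⁻ y, g i y ∂μ) atTop := by
        refine liminf_le_liminf (Eventually.of_forall fun i => ?_)
        rw [ENNReal.tsum_mul_left, mul_assoc]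
        gcongr
        exact tsum_setLIntegral_le_of_overlap hs hcs (fun _ => measurableSet_ball)
          (hg i).1.aemeasurable
    _ = ENNReal.ofReal (CP * r) * C₀ * liminf (fun i => ∫⁻ y, g i y ∂μ) atTop :=
        ENNReal.liminf_const_mul_of_ne_zero_of_ne_top hK0 hKt

lemma totalVariation_le_lintegral {μ : Measure X} {v : X → ℝ} {g : X → ℝ≥0∞}
    (hv : LocLipschitzOn v univ) (hg : IsUpperGradient g v) :
    totalVariation μ v univ ≤ ∫⁻ x, g x ∂μ := by
  refine iInf_le_of_le (fun _ => v) (iInf_le_of_le (fun _ => g) (iInf_le_of_le (fun _ => hv)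
    (iInf_le_of_le (fun _ => hg) (iInf_le_of_le (fun K _ _ => ?_) ?_))))
  · simp
  · simp

lemma locLipschitzOn_univ_of_locallyLipschitz {v : X → ℝ} (hv : LocallyLipschitz v) :
    LocLipschitzOn v univ := fun _ _ hK =>
  LocallyLipschitzOn.exists_lipschitzOnWith_of_compact hK hv.locallyLipschitzOn

lemma eL1Norm_tsum_setAverage_mul_le [OpensMeasurableSpace X] {μ : Measure X}
    {Cd : ℝ≥0} (hμ : DoublingWith μ Cd) {u : X → ℝ} (hu : Integrable u μ) {c : ℕ → X}
    {r : ℝ} (hr : 0 < r) {s : ℕ → Set X} {C₀ : ℕ}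
    (hs : ∀ k, {j | (s j ∩ s k).Nonempty}.Finite ∧ {j | (s j ∩ s k).Nonempty}.ncard ≤ C₀)
    (hcs : ∀ k, ball (c k) r ⊆ s k) {φ : ℕ → X → ℝ} (hφm : ∀ j, Measurable (φ j))
    (hφ : ∀ j z, 0 ≤ φ j z ∧ φ j z ≤ 1) (hφs : ∀ j, ∀ z ∉ ball (c j) r, φ j z = 0) :
    eL1Norm μ (fun z => ∑' j, (⨍ y in ball (c j) r, u y ∂μ) * φ j z) ≤ C₀ * eL1Norm μ u := by
  set a : ℕ → ℝ := fun j => ⨍ y in ball (c j) r, u y ∂μ with ha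
  calc eL1Norm μ (fun z => ∑' j, a j * φ j z)
      ≤ ∫⁻ z, ∑' j, ENNReal.ofReal |a j| * ENNReal.ofReal (φ j z) ∂μ := by
        refine lintegral_mono fun z => ?_
        have := enorm_tsum_le_tsum_enorm (f := fun j => a j * φ j z)
        simpa only [Real.enorm_eq_ofReal_abs, abs_mul, abs_of_nonneg (hφ _ z).1,
          ENNReal.ofReal_mul (abs_nonneg _)] using this
    _ = ∑' j, ENNReal.ofReal |a j| * ∫⁻ z, ENNReal.ofReal (φ j z) ∂μ := by
        rw [lintegral_tsum fun j => ((hφm j).ennreal_ofReal.const_mul _).aemeasurable]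
        simp_rw [lintegral_const_mul _ (hφm _).ennreal_ofReal]
    _ ≤ ∑' j, ∫⁻ y in ball (c j) r, ENNReal.ofReal |u y| ∂μ := by
        refine ENNReal.tsum_le_tsum fun j => ?_
        obtain ⟨h0, -, ht⟩ := hμ (c j) r hr
        have h1 := ofReal_abs_setAverage_sub_le h0.ne' ht.ne hu.integrableOn 0
        simp only [sub_zero] at h1
        have h2 : ∫⁻ z, ENNReal.ofReal (φ j z) ∂μ ≤ μ (ball (c j) r) := by
          rw [← lintegral_indicator_one measurableSet_ball]
          refine lintegral_mono fun z => ?_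
          by_cases hz : z ∈ ball (c j) r
          · simpa [hz] using (hφ j z).2
          · simp [hφs j z hz]
        calc _ ≤ (∫⁻ y in ball (c j) r, ENNReal.ofReal |u y| ∂μ) / μ (ball (c j) r) *
              μ (ball (c j) r) := by gcongr
          _ = _ := ENNReal.div_mul_cancel h0.ne' ht.ne
    _ ≤ C₀ * eL1Norm μ u := tsum_setLIntegral_le_of_overlap hs hcs (fun _ => measurableSet_ball)
        hu.aemeasurable.abs.ennreal_ofReal

/-- **Discrete convolutions of BV functions.** Given a covering of `X` by balls
`B(x_j, R)` whose dilations `B(x_j, 10λR)` have overlap bounded by `C₀ = C₀(Cd)`,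
and a subordinate partition of unity `φ_j` of Lipschitz constant `L/R`, the
discrete convolution `v = Σ_j u_{B(x_j,5R)} φ_j` of `u ∈ BV(X)` satisfies
`v ∈ N^{1,1}(X) ∩ BV(X)` and `‖v‖_{BV(X)} ≤ C ‖u‖_{BV(X)}`. -/
theorem discrete_convolution_bv_bound
    (Cd : ℝ≥0) (CP lam : ℝ) (hCd : 1 ≤ Cd) (hCP : 0 < CP) (hlam : 1 ≤ lam)
    (C₀ : ℕ) (L : ℝ≥0) :
    ∃ C : ℝ≥0, 1 ≤ C ∧
      ∀ (X : Type) [MetricSpace X] [CompleteSpace X] [Nontrivial X]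
        [MeasurableSpace X] [BorelSpace X] (μ : Measure X),
        DoublingWith μ Cd → PoincareIneq μ CP lam →
        ∀ (R : ℝ), 0 < R → ∀ (c : ℕ → X) (φ : ℕ → X → ℝ),
          (∀ z : X, ∃ j, z ∈ ball (c j) R) →
          (∀ k : ℕ,
            {j : ℕ | (ball (c j) (10 * lam * R) ∩
              ball (c k) (10 * lam * R)).Nonempty}.Finite ∧
            {j : ℕ | (ball (c j) (10 * lam * R) ∩
              ball (c k) (10 * lam * R)).Nonempty}.ncard ≤ C₀) →
          (∀ (j : ℕ) (z : X), 0 ≤ φ j z ∧ φ j z ≤ 1) →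
          (∀ j : ℕ, LipschitzWith (L * (Real.toNNReal R)⁻¹) (φ j)) →
          (∀ j : ℕ, tsupport (φ j) ⊆ ball (c j) (2 * R)) →
          (∀ z : X, HasSum (fun j => φ j z) 1) →
          ∀ u : X → ℝ, MemBV μ u →
            MemN11 μ (fun z => ∑' j, (⨍ y in ball (c j) (5 * R), u y ∂μ) * φ j z) ∧
            MemBV μ (fun z => ∑' j, (⨍ y in ball (c j) (5 * R), u y ∂μ) * φ j z) ∧
            eBVNorm μ (fun z => ∑' j, (⨍ y in ball (c j) (5 * R), u y ∂μ) * φ j z) ≤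
              (C : ℝ≥0∞) * eBVNorm μ u := by
  refine ⟨1 + C₀ + 8 * C₀ ^ 2 * Cd ^ 2 * L * CP.toNNReal,
    by rw [add_assoc]; exact le_self_add, ?_⟩
  intro X _ _ _ _ _ μ hμ hP R hR c φ hcov hover hφ hφL hφs hφsum u hu
  have := hμ.properSpace
  obtain ⟨hui, huTV⟩ := hu
  have hlamR : R ≤ lam * R := le_mul_of_one_le_left hR.le hlam
  have hC₀ : C₀ ≠ 0 := by
    obtain ⟨hfin, hcard⟩ := hover 0
    refine (lt_of_lt_of_le ((ncard_pos hfin).2 ⟨0, c 0, ?_⟩) hcard).ne'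
    exact ⟨mem_ball_self (by nlinarith), mem_ball_self (by nlinarith)⟩
  have hφ0 : ∀ j z, z ∉ ball (c j) (2 * R) → φ j z = 0 := fun j z hz =>
    image_eq_zero_of_notMem_tsupport fun h => hz (hφs j h)
  have hφm : ∀ j, Measurable (φ j) := fun j => (hφL j).continuous.measurable
  set a : ℕ → ℝ := fun j => ⨍ y in ball (c j) (5 * R), u y ∂μ with ha
  set v : X → ℝ := fun z => ∑' j, a j * φ j z with hv
  have hL1 : eL1Norm μ v ≤ C₀ * eL1Norm μ u :=
    eL1Norm_tsum_setAverage_mul_le hμ hui (by positivity) hover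
      (fun k => ball_subset_ball (by nlinarith)) hφm hφ
      fun j z hz => hφ0 j z fun h => hz (ball_subset_ball (by linarith) h)
  set D : ℕ → ℝ≥0∞ := fun k => meanDeviation μ u (ball (c k) (8 * R)) with hD
  have hDsum : ∑' k, D k ≤ ENNReal.ofReal (CP * (8 * R)) * C₀ * totalVariation μ u univ :=
    hP.tsum_meanDeviation_le hμ hCP hlam (by positivity) hover hC₀
      (fun k => ball_subset_ball (by nlinarith)) hui
  have hDt : ∀ k, D k ≠ ⊤ := fun k => ne_top_of_le_ne_top
    (ENNReal.mul_ne_top (by finiteness) huTV.ne) ((ENNReal.le_tsum k).trans hDsum)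
  set A : ℕ → ℝ≥0 := fun k => (Cd ^ 2 * D k / μ (ball (c k) (8 * R))).toNNReal with hA
  have hAcoe : ∀ k, (A k : ℝ≥0∞) = Cd ^ 2 * D k / μ (ball (c k) (8 * R)) := fun k =>
    ENNReal.coe_toNNReal (ENNReal.div_ne_top (ENNReal.mul_ne_top (by finiteness) (hDt k))
      (hμ _ _ (by positivity)).1.ne')
  set Λ : ℝ≥0 := L * (Real.toNNReal R)⁻¹ with hΛ
  have hlip : ∀ k, LipschitzOnWith (C₀ * A k * Λ) v (ball (c k) R) := by
    intro k
    obtain ⟨hfin, hcard⟩ := hover k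
    rw [ncard_eq_toFinset_card _ hfin] at hcard
    refine lipschitzOnWith_tsum_mul (N := hfin.toFinset.filter fun j => dist (c j) (c k) ≤ 3 * R)
      (b := ⨍ z in ball (c k) (8 * R), u z ∂μ)
      ((Finset.card_filter_le _ _).trans hcard) ?_ hφL hφsum ?_
    · intro j hj z hz
      by_contra hne
      have hzj : z ∈ ball (c j) (2 * R) := by
        by_contra h
        exact hne (hφ0 j z h)
      refine hj (Finset.mem_filter.2 ⟨hfin.mem_toFinset.2 ⟨z, ?_, ?_⟩, ?_⟩)
      · exact ball_subset_ball (by nlinarith) hzj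
      · exact ball_subset_ball (by nlinarith) hz
      · have := dist_triangle_left (c j) (c k) z
        rw [mem_ball] at hz hzj
        linarith
    · intro j hj
      have := hμ.ofReal_abs_setAverage_sub_setAverage_le hui hR (Finset.mem_filter.1 hj).2
      rw [← hAcoe k] at this
      exact (ENNReal.ofReal_le_ofReal_iff (A k).2).1 (by simpa using this)
  have hloclip : LocallyLipschitz v := fun x =>
    let ⟨k, hk⟩ := hcov x
    ⟨_, _, isOpen_ball.mem_nhds hk, hlip k⟩
  have hvm : Measurable v := hloclip.continuous.measurable
  obtain ⟨g, hg, hgint⟩ : ∃ g, IsUpperGradient g v ∧ ∫⁻ x, g x ∂μ ≤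
      (8 * C₀ ^ 2 * Cd ^ 2 * L * CP.toNNReal : ℝ≥0) * totalVariation μ u univ := by
    refine ⟨_, isUpperGradient_of_lipschitzOnWith (fun _ => isOpen_ball) hcov hlip, ?_⟩
    rw [lintegral_tsum fun k => (measurable_const.indicator measurableSet_ball).aemeasurable]
    simp_rw [lintegral_indicator_const measurableSet_ball]
    calc ∑' k, ((C₀ * A k * Λ : ℝ≥0) : ℝ≥0∞) * μ (ball (c k) R)
        ≤ ∑' k, (C₀ * Λ * Cd ^ 2 : ℝ≥0) * D k := by
          refine ENNReal.tsum_le_tsum fun k => ?_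
          obtain ⟨h0, -, ht⟩ := hμ (c k) (8 * R) (by positivity)
          have h1 : (A k : ℝ≥0∞) * μ (ball (c k) R) ≤ Cd ^ 2 * D k := by
            calc (A k : ℝ≥0∞) * μ (ball (c k) R)
                ≤ A k * μ (ball (c k) (8 * R)) := by gcongr; linarith
              _ = Cd ^ 2 * D k := by rw [hAcoe, ENNReal.div_mul_cancel h0.ne' ht.ne]
          calc ((C₀ * A k * Λ : ℝ≥0) : ℝ≥0∞) * μ (ball (c k) R)
              = C₀ * Λ * (A k * μ (ball (c k) R)) := by push_cast; ring
            _ ≤ C₀ * Λ * (Cd ^ 2 * D k) := by gcongr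
            _ = _ := by push_cast; ring
      _ = (C₀ * Λ * Cd ^ 2 : ℝ≥0) * ∑' k, D k := ENNReal.tsum_mul_left
      _ ≤ (C₀ * Λ * Cd ^ 2 : ℝ≥0) *
            (ENNReal.ofReal (CP * (8 * R)) * C₀ * totalVariation μ u univ) := by gcongr
      _ = (C₀ * Λ * Cd ^ 2 * ((CP * (8 * R)).toNNReal * C₀) : ℝ≥0) * totalVariation μ u univ := by
          rw [ENNReal.ofReal]; push_cast; ring
      _ = _ := by
          congr 2
          have hR' : R.toNNReal ≠ 0 := (Real.toNNReal_pos.2 hR).ne'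
          rw [hΛ, Real.toNNReal_mul hCP.le, Real.toNNReal_mul (by norm_num),
            Real.toNNReal_ofNat]
          field_simp
  have hvTV : totalVariation μ v univ ≤ ∫⁻ x, g x ∂μ :=
    totalVariation_le_lintegral (locLipschitzOn_univ_of_locallyLipschitz hloclip) hg
  have hgt : ∫⁻ x, g x ∂μ < ⊤ := hgint.trans_lt (ENNReal.mul_lt_top (by finiteness) huTV)
  have hut : eL1Norm μ u < ⊤ := by
    have := hui.2
    simpa only [HasFiniteIntegral, Real.enorm_eq_ofReal_abs, eL1Norm] using this
  have hvt : eL1Norm μ v < ⊤ := hL1.trans_lt (ENNReal.mul_lt_top (by finiteness) hut)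
  refine ⟨⟨hvm, ENNReal.add_lt_top.2 ⟨hvt, (iInf₂_le g hg).trans_lt hgt⟩⟩,
    ⟨⟨hvm.aestronglyMeasurable, ?_⟩, hvTV.trans_lt hgt⟩, ?_⟩
  · simpa only [HasFiniteIntegral, Real.enorm_eq_ofReal_abs, eL1Norm] using hvt
  · rw [eBVNorm, eBVNorm, mul_add]
    refine add_le_add (hL1.trans ?_) ((hvTV.trans hgint).trans ?_)
    · gcongr
      push_cast
      rw [add_right_comm]
      exact le_add_self
    · gcongr
      exact le_add_self

end FineBV
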